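/- Let C ∈ (ℝ²)*⊗(ℝ²)*⊗ℝ² be such that the symmetric matrix ρ_{s,C} is nondegenerate (det ρ_{s,C} ≠ 0). If a ∈ ℝ and b > 0 satisfy M_{a,b}·C = C, then a = 0 and b = 1. (The group of maps (x¹,x²) ↦ (x¹, ax¹ + bx²), b > 0, acts without fixed points on the set of Type B structures with nondegenerate symmetric Ricci tensor.) -/

import Mathlib

open scoped BigOperators
open Matrix

/-- The Ricci matrix `ρ_C` of the Type B connection with Christoffel symbols
`Γ_{ij}{}^k = C_{ij}{}^k/x¹` (evaluated at `x¹ = 1`; indices are 0-based, so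
`C 0 0 0 = C₁₁¹`, etc.). -/
noncomputable def rhoC (C : Fin 2 → Fin 2 → Fin 2 → ℝ) : Matrix (Fin 2) (Fin 2) ℝ :=
  !![(C 0 0 0 - C 0 1 1 + 1) * C 1 0 1 + C 0 0 1 * (C 1 1 1 - C 1 0 0),
     C 1 1 1 + C 0 1 0 * C 1 0 1 - C 0 0 1 * C 1 1 0;
     -C 1 0 0 + C 0 1 0 * C 1 0 1 - C 0 0 1 * C 1 1 0,
     (C 0 0 0 - C 0 1 1 - 1) * C 1 1 0 + C 0 1 0 * (C 1 1 1 - C 1 0 0)]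

/-- The symmetric Ricci matrix `ρ_{s,C} = (ρ_C + ρ_Cᵀ)/2`. -/
noncomputable def rhoS (C : Fin 2 → Fin 2 → Fin 2 → ℝ) : Matrix (Fin 2) (Fin 2) ℝ :=
  (1 / 2 : ℝ) • (rhoC C + (rhoC C)ᵀ)
/-- The shear-dilation matrix `M_{a,b}`, i.e. the linear map with
`M e₁ = e₁ + a e₂` and `M e₂ = b e₂` (corresponding to the coordinate change
`(x¹,x²) ↦ (x¹, a x¹ + b x²)`). -/
noncomputable def Mab (a b : ℝ) : Matrix (Fin 2) (Fin 2) ℝ := !![1, 0; a, b]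

/-- The natural tensor action of an invertible matrix `M` on
`C ∈ (ℝ²)* ⊗ (ℝ²)* ⊗ ℝ²`: the two covariant slots transform by `M⁻¹` and the
contravariant slot by `M`. -/
noncomputable def tensorAct (M : Matrix (Fin 2) (Fin 2) ℝ)
    (C : Fin 2 → Fin 2 → Fin 2 → ℝ) : Fin 2 → Fin 2 → Fin 2 → ℝ :=
  fun i j k => ∑ p : Fin 2, ∑ q : Fin 2, ∑ r : Fin 2,
    M⁻¹ p i * M⁻¹ q j * M k r * C p q r

theorem inv_Mab (a : ℝ) {b : ℝ} (hb : b ≠ 0) : (Mab a b)⁻¹ = !![1, 0; -a / b, 1 / b] := by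
  apply Matrix.inv_eq_left_inv
  ext i j
  fin_cases i <;> fin_cases j <;> simp [Mab, Matrix.mul_apply, Fin.sum_univ_two]
  all_goals field_simp
  all_goals ring

/-- The symmetric Ricci matrix degenerates when all components of `C`, other than the
`C_{12}{}^2`, `C_{21}{}^2` and `C_{11}{}^k`, vanish. -/
theorem det_rhoS_eq_zero {C : Fin 2 → Fin 2 → Fin 2 → ℝ} (h₁ : C 1 1 0 = 0)
    (h₂ : C 1 1 1 = 0) (h₃ : C 0 1 0 = 0) (h₄ : C 1 0 0 = 0) : (rhoS C).det = 0 := by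
  simp [rhoS, rhoC, Matrix.det_fin_two, h₁, h₂, h₃, h₄]

/-- The shear-dilation group `{(x¹,x²) ↦ (x¹, ax¹ + bx²) : b > 0}` acts without fixed
points on the Type B structures with nondegenerate symmetric Ricci tensor: if
`M_{a,b} · C = C` with `b > 0` and `det ρ_{s,C} ≠ 0`, then `(a,b) = (0,1)`. -/
theorem shear_dilation_fixed_point_free (C : Fin 2 → Fin 2 → Fin 2 → ℝ)
    (hdet : (rhoS C).det ≠ 0) (a b : ℝ) (hb : 0 < b)
    (hfix : tensorAct (Mab a b) C = C) :
    a = 0 ∧ b = 1 := by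
  have key (i j k : Fin 2) : tensorAct (Mab a b) C i j k = C i j k := by rw [hfix]
  have e₁ := key 1 1 0
  have e₂ := key 1 1 1
  have e₃ := key 0 1 0
  have e₄ := key 1 0 0
  have e₅ := key 0 1 1
  have e₆ := key 1 0 1
  have e₇ := key 0 0 0
  simp only [tensorAct, inv_Mab a hb.ne'] at e₁ e₂ e₃ e₄ e₅ e₆ e₇
  simp [Mab, Fin.sum_univ_two] at e₁ e₂ e₃ e₄ e₅ e₆ e₇
  have hb1 : b = 1 := by
    by_contra hne
    have hsub : b - 1 ≠ 0 := sub_ne_zero.mpr hne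
    have h₁ : C 1 1 0 = 0 := by
      field_simp at e₁
      have : (b - 1) * ((b + 1) * C 1 1 0) = 0 := by linear_combination -e₁
      simpa [hsub, (by positivity : b + 1 ≠ 0)] using this
    have h₂ : C 1 1 1 = 0 := by
      simp only [h₁] at e₂
      field_simp at e₂
      have : (b - 1) * (b * C 1 1 1) = 0 := by linear_combination -e₂
      simpa [hsub, hb.ne'] using this
    have h₃ : C 0 1 0 = 0 := by
      simp only [h₁] at e₃
      field_simp at e₃
      have : (b - 1) * (b * C 0 1 0) = 0 := by linear_combination -e₃
      simpa [hsub, hb.ne'] using this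
    have h₄ : C 1 0 0 = 0 := by
      simp only [h₁] at e₄
      field_simp at e₄
      have : (b - 1) * (b * C 1 0 0) = 0 := by linear_combination -e₄
      simpa [hsub, hb.ne'] using this
    exact hdet (det_rhoS_eq_zero h₁ h₂ h₃ h₄)
  refine ⟨?_, hb1⟩
  subst hb1
  by_contra ha
  have h₁ : C 1 1 0 = 0 := mul_left_cancel₀ ha (by linear_combination e₂)
  simp only [h₁] at e₃ e₄ e₅ e₆ e₇
  have h₃ : C 0 1 0 = C 1 1 1 := mul_left_cancel₀ ha (by linear_combination e₅)
  have h₄ : C 1 0 0 = C 1 1 1 := mul_left_cancel₀ ha (by linear_combination e₆)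
  rw [h₃, h₄] at e₇
  have h₂ : C 1 1 1 = 0 := mul_left_cancel₀ ha (by linear_combination -e₇ / 2)
  exact hdet (det_rhoS_eq_zero h₁ h₂ (h₃.trans h₂) (h₄.trans h₂))
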